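/- Let n, p, q be integers with p ≥ 1, q ≥ 1 and n ≥ p + q + 4, and let T = T(p, n−p−q−3, q) be the caterpillar of order n. Then the Randić energy of T equals 2(1 + √(α(n,p,q) + β(n,p,q)) + √(α(n,p,q) − β(n,p,q))). -/

import Mathlib

open Polynomial

open scoped Classical in
/-- The Randić matrix of a simple graph `G`: the `(u,v)` entry is `1/√(d_u d_v)` when `uv` is
an edge and `0` otherwise, where `d_v` is the degree of the vertex `v`. -/
noncomputable def randicMatrix {V : Type*} (G : SimpleGraph V) : Matrix V V ℝ :=
  Matrix.of fun u v =>
    if G.Adj u v then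
      1 / Real.sqrt (((G.neighborSet u).ncard : ℝ) * ((G.neighborSet v).ncard : ℝ))
    else 0

lemma randicMatrix_isHermitian {V : Type*} (G : SimpleGraph V) :
    (randicMatrix G).IsHermitian := by
  ext u v
  by_cases h : G.Adj u v
  · simp [randicMatrix, Matrix.conjTranspose_apply, h, h.symm, mul_comm]
  · have h' : ¬ G.Adj v u := fun hc => h hc.symm
    simp [randicMatrix, Matrix.conjTranspose_apply, h, h']

/-- The Randić energy of a graph: the sum of the absolute values of the eigenvalues of its
Randić matrix. -/
noncomputable def randicEnergy {V : Type*} [Fintype V] [DecidableEq V] (G : SimpleGraph V) : ℝ :=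
  ∑ i, |(randicMatrix_isHermitian G).eigenvalues i|

/-- The caterpillar `T(p 0, …, p (r-1))`: a path `v_0 v_1 ⋯ v_{r-1}` (the `Sum.inl` vertices)
together with, for each `i`, `p i` pendant vertices attached to `v_i` (the `Sum.inr` vertices). -/
def caterpillar (r : ℕ) (p : Fin r → ℕ) :
    SimpleGraph ((Fin r) ⊕ (Σ i : Fin r, Fin (p i))) :=
  SimpleGraph.fromRel (fun u v =>
    (∃ i j : Fin r, u = Sum.inl i ∧ v = Sum.inl j ∧ (i : ℕ) + 1 = (j : ℕ)) ∨
    (∃ (i : Fin r) (k : Fin (p i)), u = Sum.inl i ∧ v = Sum.inr ⟨i, k⟩))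

namespace Matrix

/-- A division-free Schur complement formula for a block matrix whose lower right block is
scalar. -/
lemma det_fromBlocks_scalar₂₂ {R m n : Type*} [CommRing R] [Fintype m] [Fintype n]
    [DecidableEq m] [DecidableEq n] (x : R) (A : Matrix m m R) (B : Matrix m n R)
    (C : Matrix n m R) :
    x ^ Fintype.card m * (fromBlocks A B C (scalar n x)).det
      = x ^ Fintype.card n * (x • A - B * C).det := by
  have h : fromBlocks A B C (scalar n x) * fromBlocks (scalar m x) 0 (-C) 1
      = fromBlocks (x • A - B * C) B 0 (scalar n x) := by
    rw [fromBlocks_multiply]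
    congr 1
    · ext i j
      simp [mul_comm, sub_eq_add_neg]
    · simp
    · ext i j
      simp [mul_comm]
    · simp
  have h' := congrArg det h
  rw [det_mul, det_fromBlocks_zero₁₂, det_fromBlocks_zero₂₁] at h'
  simp only [scalar_apply, det_diagonal, Finset.prod_const, Finset.card_univ, det_one,
    mul_one] at h'
  rw [mul_comm, scalar_apply, h', mul_comm]

/-- The characteristic polynomial of a block matrix whose lower right block vanishes. -/
lemma X_pow_mul_charpoly_fromBlocks_zero₂₂ {R m n : Type*} [CommRing R] [Fintype m] [Fintype n]
    [DecidableEq m] [DecidableEq n] (A : Matrix m m R) (B : Matrix m n R) (D : Matrix n m R) :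
    (X : R[X]) ^ Fintype.card m * (fromBlocks A B D 0).charpoly
      = X ^ Fintype.card n
        * ((X : R[X]) • A.charmatrix - (B * D).map (Polynomial.C : R → R[X])).det := by
  have h0 : (0 : Matrix n n R).charmatrix = scalar n (X : R[X]) := by
    simp [charmatrix]
  rw [charpoly, charmatrix_fromBlocks, h0, det_fromBlocks_scalar₂₂, Matrix.map_mul]
  simp

end Matrix

namespace Polynomial

/-- The sum of the absolute values of the real roots, with multiplicity. -/
noncomputable def absRootSum (f : ℝ[X]) : ℝ := (f.roots.map abs).sum

lemma absRootSum_mul {f g : ℝ[X]} (h : f * g ≠ 0) :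
    absRootSum (f * g) = absRootSum f + absRootSum g := by
  simp [absRootSum, roots_mul h]

lemma absRootSum_X_pow (k : ℕ) : absRootSum (X ^ k) = 0 := by
  simp [absRootSum, Multiset.map_nsmul, Multiset.sum_nsmul]

lemma absRootSum_X_sq_sub_C {y : ℝ} (hy : 0 ≤ y) :
    absRootSum (X ^ 2 - C y) = 2 * Real.sqrt y := by
  have h : (X ^ 2 - C y : ℝ[X]) = (X - C (Real.sqrt y)) * (X - C (-Real.sqrt y)) := by
    conv_lhs => rw [← Real.sq_sqrt hy]
    simp only [map_neg, map_pow]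
    ring
  rw [h, absRootSum_mul (mul_ne_zero (X_sub_C_ne_zero _) (X_sub_C_ne_zero _))]
  simp only [absRootSum, roots_X_sub_C, Multiset.map_singleton, Multiset.sum_singleton, abs_neg,
    abs_of_nonneg (Real.sqrt_nonneg y)]
  ring

end Polynomial

lemma randicEnergy_eq_absRootSum {V : Type*} [Fintype V] [DecidableEq V] (G : SimpleGraph V) :
    randicEnergy G = absRootSum (randicMatrix G).charpoly := by
  rw [absRootSum, (randicMatrix_isHermitian G).roots_charpoly_eq_eigenvalues]
  simp [randicEnergy]

section caterpillar

variable {r : ℕ} {p : Fin r → ℕ}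

lemma caterpillar_adj_inl_inl (i j : Fin r) :
    (caterpillar r p).Adj (Sum.inl i) (Sum.inl j) ↔
      (i : ℕ) + 1 = j ∨ (j : ℕ) + 1 = i := by
  simp only [caterpillar, SimpleGraph.fromRel_adj]
  constructor
  · rintro ⟨-, (⟨a, b, h1, h2, h⟩ | ⟨a, b, h1, h2⟩) | (⟨a, b, h1, h2, h⟩ | ⟨a, b, h1, h2⟩)⟩ <;>
      simp_all
  · intro h
    refine ⟨fun e => ?_, h.imp (fun h => .inl ⟨i, j, rfl, rfl, h⟩)
      fun h => .inl ⟨j, i, rfl, rfl, h⟩⟩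
    obtain rfl := Sum.inl.inj e
    omega

lemma caterpillar_adj_inl_inr (i : Fin r) (x : Σ i : Fin r, Fin (p i)) :
    (caterpillar r p).Adj (Sum.inl i) (Sum.inr x) ↔ i = x.1 := by
  simp only [caterpillar, SimpleGraph.fromRel_adj]
  constructor
  · rintro ⟨-, (⟨a, b, h1, h2, h⟩ | ⟨a, b, h1, h2⟩) | (⟨a, b, h1, h2, h⟩ | ⟨a, b, h1, h2⟩)⟩ <;>
      simp_all
  · rintro rfl
    exact ⟨by simp, .inl (.inr ⟨x.1, x.2, rfl, rfl⟩)⟩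

lemma caterpillar_not_adj_inr_inr (x y : Σ i : Fin r, Fin (p i)) :
    ¬ (caterpillar r p).Adj (Sum.inr x) (Sum.inr y) := by
  simp [caterpillar, SimpleGraph.fromRel_adj]

lemma caterpillar_ncard_neighborSet_inr (x : Σ i : Fin r, Fin (p i)) :
    ((caterpillar r p).neighborSet (Sum.inr x)).ncard = 1 := by
  rw [Set.ncard_eq_one]
  refine ⟨Sum.inl x.1, ?_⟩
  ext (j | y)
  · simp [SimpleGraph.adj_comm _ (Sum.inr x), caterpillar_adj_inl_inr]
  · simp [caterpillar_not_adj_inr_inr]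

lemma caterpillar_ncard_neighborSet_inl (i : Fin r) :
    ((caterpillar r p).neighborSet (Sum.inl i)).ncard
      = (Finset.univ.filter fun j : Fin r => (i : ℕ) + 1 = j ∨ (j : ℕ) + 1 = i).card + p i := by
  have h : (caterpillar r p).neighborSet (Sum.inl i)
      = ((Finset.univ.filter fun j : Fin r => (i : ℕ) + 1 = j ∨ (j : ℕ) + 1 = i).disjSum
          ((Finset.univ : Finset (Fin (p i))).map (Function.Embedding.sigmaMk i)) :
            Finset (Fin r ⊕ Σ i : Fin r, Fin (p i))) := by
    ext (j | ⟨j, k⟩)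
    · simp [caterpillar_adj_inl_inl]
    · simp only [SimpleGraph.mem_neighborSet, caterpillar_adj_inl_inr, Finset.mem_coe,
        Finset.inr_mem_disjSum, Finset.mem_map, Finset.mem_univ, true_and]
      constructor
      · rintro rfl
        exact ⟨k, rfl⟩
      · rintro ⟨l, hl⟩
        exact congrArg Sigma.fst hl
  rw [h, Set.ncard_coe_finset, Finset.card_disjSum, Finset.card_map, Finset.card_univ,
    Fintype.card_fin]

/-- The number of neighbours of the spine vertex `i` of a caterpillar. -/
noncomputable def spineDegree (p : Fin r → ℕ) (i : Fin r) : ℝ :=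
  ((caterpillar r p).neighborSet (Sum.inl i)).ncard

/-- The spine block of the Randić matrix of a caterpillar. -/
noncomputable def spineBlock (p : Fin r → ℕ) : Matrix (Fin r) (Fin r) ℝ :=
  Matrix.of fun i j => if (i : ℕ) + 1 = j ∨ (j : ℕ) + 1 = i then
    1 / Real.sqrt (spineDegree p i * spineDegree p j) else 0

/-- The block of the Randić matrix of a caterpillar joining the spine to the leaves. -/
noncomputable def leafBlock (p : Fin r → ℕ) : Matrix (Fin r) (Σ i : Fin r, Fin (p i)) ℝ :=
  Matrix.of fun i x => if i = x.1 then 1 / Real.sqrt (spineDegree p i) else 0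

lemma randicMatrix_caterpillar (p : Fin r → ℕ) :
    randicMatrix (caterpillar r p)
      = Matrix.fromBlocks (spineBlock p) (leafBlock p) (leafBlock p).transpose 0 := by
  ext (i | x) (j | y)
  · simp [randicMatrix, spineBlock, spineDegree, caterpillar_adj_inl_inl]
  · simp [randicMatrix, leafBlock, spineDegree, caterpillar_adj_inl_inr,
      caterpillar_ncard_neighborSet_inr]
  · by_cases h : j = x.1 <;>
    simp [randicMatrix, leafBlock, spineDegree, caterpillar_adj_inl_inr,
      caterpillar_ncard_neighborSet_inr, SimpleGraph.adj_comm _ (Sum.inr x), h]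
  · simp [randicMatrix, caterpillar_not_adj_inr_inr]

lemma leafBlock_mul_transpose (p : Fin r → ℕ) :
    leafBlock p * (leafBlock p).transpose
      = Matrix.diagonal fun i => (p i : ℝ) / spineDegree p i := by
  ext i j
  simp only [Matrix.mul_apply, leafBlock, Matrix.transpose_apply, Matrix.of_apply,
    Fintype.sum_sigma]
  rw [Finset.sum_eq_single i (by intro b _ hb; simp [hb.symm]) (by simp)]
  by_cases h : i = j
  · subst h
    have : 0 ≤ spineDegree p i := Nat.cast_nonneg _
    simp [← mul_inv, Real.mul_self_sqrt this, div_eq_mul_inv]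
  · simp [h, Ne.symm h]

end caterpillar

/-- The Randić characteristic polynomial of a caterpillar with three spine vertices. -/
lemma X_pow_mul_charpoly_caterpillar_three (p m q : ℕ) :
    (X : ℝ[X]) ^ 3 * (randicMatrix (caterpillar 3 ![p, m, q])).charpoly
      = X ^ (p + m + q) * ((X ^ 2 - C 1) *
        (X ^ 4 - C (((m : ℝ) + 1) / (m + 2) * ((p : ℝ) / (p + 1) + q / (q + 1))) * X ^ 2
          + C ((p : ℝ) / (p + 1) * (m / (m + 2)) * (q / (q + 1))))) := by
  have d0 : spineDegree ![p, m, q] 0 = p + 1 := by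
    rw [spineDegree, caterpillar_ncard_neighborSet_inl,
      show (Finset.univ.filter fun j : Fin 3 => ((0 : Fin 3) : ℕ) + 1 = j ∨
        (j : ℕ) + 1 = (0 : Fin 3)).card = 1 by decide]
    simp [add_comm]
  have d1 : spineDegree ![p, m, q] 1 = m + 2 := by
    rw [spineDegree, caterpillar_ncard_neighborSet_inl,
      show (Finset.univ.filter fun j : Fin 3 => ((1 : Fin 3) : ℕ) + 1 = j ∨
        (j : ℕ) + 1 = (1 : Fin 3)).card = 2 by decide]
    simp [add_comm]
  have d2 : spineDegree ![p, m, q] 2 = q + 1 := by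
    rw [spineDegree, caterpillar_ncard_neighborSet_inl,
      show (Finset.univ.filter fun j : Fin 3 => ((2 : Fin 3) : ℕ) + 1 = j ∨
        (j : ℕ) + 1 = (2 : Fin 3)).card = 1 by decide]
    simp [add_comm]
  have h := Matrix.X_pow_mul_charpoly_fromBlocks_zero₂₂ (spineBlock ![p, m, q])
    (leafBlock ![p, m, q]) (leafBlock ![p, m, q]).transpose
  rw [← randicMatrix_caterpillar, leafBlock_mul_transpose] at h
  simp only [Fintype.card_fin, Fintype.card_sigma, Fin.sum_univ_three] at h
  refine h.trans ?_
  have hb : (1 / Real.sqrt (((p : ℝ) + 1) * (m + 2))) ^ 2 = 1 / ((p + 1) * (m + 2)) := by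
    rw [div_pow, Real.sq_sqrt (by positivity), one_pow]
  have hc : (1 / Real.sqrt (((m : ℝ) + 2) * (q + 1))) ^ 2 = 1 / ((m + 2) * (q + 1)) := by
    rw [div_pow, Real.sq_sqrt (by positivity), one_pow]
  congr 1
  rw [Matrix.det_fin_three]
  simp only [Matrix.sub_apply, Matrix.smul_apply, Matrix.map_apply, Matrix.charmatrix_apply,
    spineBlock, Matrix.of_apply, Matrix.diagonal_apply, d0, d1, d2]
  simp only [mul_comm ((m : ℝ) + 2) ((p : ℝ) + 1), mul_comm ((q : ℝ) + 1) ((m : ℝ) + 2)]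
  generalize 1 / Real.sqrt (((p : ℝ) + 1) * (m + 2)) = b at *
  generalize 1 / Real.sqrt (((m : ℝ) + 2) * (q + 1)) = c at *
  apply Polynomial.funext
  intro x
  simp
  linear_combination (norm := skip) -(x ^ 2 - (p : ℝ) / (p + 1)) * x ^ 2 * hc
    - (x ^ 2 - (q : ℝ) / (q + 1)) * x ^ 2 * hb
  field_simp
  ring

/-- For integers `p, q ≥ 1`, `n ≥ p + q + 4`, the Randić energy of the
caterpillar `T(p, n-p-q-3, q)` of order `n` equals `2(1 + √(α + β) + √(α - β))` where
`α = ζ/(2η)`, `γ = χ/η`, `β = √(α² - γ)`, `η = (p+1)(q+1)(n-p-q-1)`,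
`ζ = (n-p-q-2)(q(2p+1)+p)` and `χ = pq(n-p-q-3)`. -/
theorem caterpillar3_randicEnergy (n p q : ℕ) (hp : 1 ≤ p) (hq : 1 ≤ q)
    (hn : p + q + 4 ≤ n) :
    let η : ℝ := ((p : ℝ) + 1) * ((q : ℝ) + 1) * ((n : ℝ) - p - q - 1)
    let ζ : ℝ := ((n : ℝ) - p - q - 2) * ((q : ℝ) * (2 * (p : ℝ) + 1) + (p : ℝ))
    let χ : ℝ := (p : ℝ) * (q : ℝ) * ((n : ℝ) - p - q - 3)
    let α : ℝ := ζ / (2 * η)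
    let γ : ℝ := χ / η
    let β : ℝ := Real.sqrt (α ^ 2 - γ)
    randicEnergy (caterpillar 3 ![p, n - p - q - 3, q])
      = 2 * (1 + Real.sqrt (α + β) + Real.sqrt (α - β)) := by
  intro η ζ χ α γ β
  obtain ⟨m, rfl⟩ : ∃ m, n = p + q + 3 + m := ⟨n - (p + q + 3), by omega⟩
  have hm : p + q + 3 + m - p - q - 3 = m := by omega
  rw [hm]
  have hη : η = ((p : ℝ) + 1) * (q + 1) * (m + 2) := by
    simp only [η]; push_cast; ring
  have hα : α = ((m : ℝ) + 1) / (m + 2) * ((p : ℝ) / (p + 1) + q / (q + 1)) / 2 := by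
    simp only [α, ζ, hη]; push_cast; field_simp; ring
  have hγ : γ = (p : ℝ) / (p + 1) * (m / (m + 2)) * (q / (q + 1)) := by
    simp only [γ, χ, hη]; push_cast; field_simp; ring
  have hγ0 : 0 ≤ γ := by rw [hγ]; positivity
  have hα0 : 0 ≤ α := by rw [hα]; positivity
  have hdisc : 0 ≤ α ^ 2 - γ := by
    have hk : (m : ℝ) / (m + 2) = 2 * (((m : ℝ) + 1) / (m + 2)) - 1 := by field_simp; ring
    rw [hα, hγ, hk]
    have hs : 0 ≤ (p : ℝ) / (p + 1) := by positivity
    have ht : 0 ≤ (q : ℝ) / (q + 1) := by positivity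
    generalize (p : ℝ) / (p + 1) = s at *
    generalize (q : ℝ) / (q + 1) = t at *
    generalize ((m : ℝ) + 1) / (m + 2) = k
    have h : (k * (s + t) / 2) ^ 2 - s * (2 * k - 1) * t
        = (k * (s - t) / 2) ^ 2 + s * t * (k - 1) ^ 2 := by ring
    rw [h]
    positivity
  have hβ : β ^ 2 = α ^ 2 - γ := Real.sq_sqrt hdisc
  have hβα : β ≤ α := Real.sqrt_le_iff.2 ⟨hα0, by linarith⟩
  have hβ0 : 0 ≤ β := Real.sqrt_nonneg _
  clear_value β γ α
  have key := X_pow_mul_charpoly_caterpillar_three p m q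
  have hfac : (X ^ 4 - C (((m : ℝ) + 1) / (m + 2) * ((p : ℝ) / (p + 1) + q / (q + 1))) * X ^ 2
      + C ((p : ℝ) / (p + 1) * (m / (m + 2)) * (q / (q + 1))) : ℝ[X])
      = (X ^ 2 - C (α + β)) * (X ^ 2 - C (α - β)) := by
    have h2 : ((m : ℝ) + 1) / (m + 2) * ((p : ℝ) / (p + 1) + q / (q + 1))
        = (α + β) + (α - β) := by rw [hα]; ring
    have h3 : γ = (α + β) * (α - β) := by linear_combination hβ
    rw [← hγ, h2, h3]
    simp only [map_add, map_mul]
    ring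
  rw [hfac] at key
  have hne (y : ℝ) : (X ^ 2 - C y : ℝ[X]) ≠ 0 := X_pow_sub_C_ne_zero two_pos y
  have hX (k : ℕ) : (X ^ k : ℝ[X]) ≠ 0 := pow_ne_zero _ X_ne_zero
  have hsum := congrArg absRootSum key
  rw [absRootSum_mul (mul_ne_zero (hX _) (Matrix.charpoly_monic _).ne_zero),
    absRootSum_mul (mul_ne_zero (hX _) (mul_ne_zero (hne _) (mul_ne_zero (hne _) (hne _)))),
    absRootSum_mul (mul_ne_zero (hne _) (mul_ne_zero (hne _) (hne _))),
    absRootSum_mul (mul_ne_zero (hne _) (hne _)), absRootSum_X_pow, absRootSum_X_pow,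
    absRootSum_X_sq_sub_C zero_le_one, absRootSum_X_sq_sub_C (by linarith),
    absRootSum_X_sq_sub_C (by linarith), Real.sqrt_one] at hsum
  rw [randicEnergy_eq_absRootSum]
  linarith
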